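/- arXiv:1309.3343 — 2 statements merged into one kernel-verified Lean document; each statement's English description precedes it below -/
import Mathlib

section
/- Let h ∈ 𝒮(ℝ) be nonzero and real-valued and f ∈ 𝒮(ℝⁿ), n ≥ 2. Then f(x) = 2·(2π)^{−n} (∫_ℝ |ĥ(η)|² dη)^{−1} ∫_{S^{n−1}} ∫_0^∞ [∫_0^∞ (P_h f)^(σθ, rθ) ĥ(rσ) dr] e^{iσ θ·x} σⁿ dσ dθ. -/
open MeasureTheory Real Complex SchwartzMap
open scoped RealInnerProductSpace

/-- The windowed ray transform `P_h f (u, v) = ∫ f(u + t v) h(t) dt`. -/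
noncomputable def windowedRay {n : ℕ} (h : ℝ → ℂ) (f : EuclideanSpace ℝ (Fin n) → ℂ)
    (u v : EuclideanSpace ℝ (Fin n)) : ℂ :=
  ∫ t : ℝ, f (u + t • v) * h t

/-- One-dimensional Fourier transform with convention `ĝ(ξ) = ∫ g(t) e^{-i t ξ} dt`. -/
noncomputable def ft1 (g : ℝ → ℂ) (ξ : ℝ) : ℂ :=
  ∫ t : ℝ, g t * Complex.exp (-(Complex.I * t * ξ))

/-- n-dimensional Fourier transform with convention `ĝ(ξ) = ∫ g(x) e^{-i x·ξ} dx`. -/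
noncomputable def ftn {n : ℕ} (g : EuclideanSpace ℝ (Fin n) → ℂ)
    (ξ : EuclideanSpace ℝ (Fin n)) : ℂ :=
  ∫ x : EuclideanSpace ℝ (Fin n), g x * Complex.exp (-(Complex.I * (⟪x, ξ⟫ : ℝ)))

open FourierTransform

lemma ft1_eq (h : SchwartzMap ℝ ℂ) (η : ℝ) : ft1 h η = (𝓕 h) ((2 * π)⁻¹ • η) := by
  rw [SchwartzMap.fourier_coe, Real.fourier_eq']
  unfold ft1
  congr 1; ext t
  rw [smul_eq_mul, mul_comm]
  congr 2
  have : (π : ℂ) ≠ 0 := by exact_mod_cast Real.pi_ne_zero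
  simp
  field_simp

lemma ftn_eq {n : ℕ} (f : SchwartzMap (EuclideanSpace ℝ (Fin n)) ℂ)
    (ξ : EuclideanSpace ℝ (Fin n)) : ftn f ξ = (𝓕 f) ((2 * π)⁻¹ • ξ) := by
  rw [SchwartzMap.fourier_coe, Real.fourier_eq']
  unfold ftn
  congr 1; ext t
  rw [smul_eq_mul, mul_comm]
  congr 2
  have : (π : ℂ) ≠ 0 := by exact_mod_cast Real.pi_ne_zero
  rw [inner_smul_right]
  push_cast
  field_simp

lemma ft1_sq_ne (h : SchwartzMap ℝ ℂ) (hh : h ≠ 0) : (∫ η : ℝ, ‖ft1 h η‖ ^ 2) ≠ 0 := by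
  simp_rw [ft1_eq]
  rw [Measure.integral_comp_smul volume (fun η : ℝ => ‖(𝓕 h : SchwartzMap ℝ ℂ) η‖ ^ 2) (2 * π)⁻¹,
    SchwartzMap.integral_norm_sq_fourier]
  have hpi := Real.pi_pos
  refine smul_ne_zero (by simp [hpi.ne']) ?_
  obtain ⟨t, ht⟩ : ∃ t, h t ≠ 0 := by
    by_contra! H
    exact hh (by ext t; simpa using H t)
  have hi : Integrable (fun x => ‖h x‖ ^ 2) := by
    have := (h.memLp 2 volume).integrable_norm_pow (by norm_num)
    simpa using this
  refine (integral_pos_of_integrable_nonneg_nonzero (x := t) (h.continuous.norm.pow 2) hi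
    (fun _ => sq_nonneg _) (by simpa using ht)).ne'

lemma ft1_neg (h : SchwartzMap ℝ ℂ) (hreal : ∀ t : ℝ, (h t).im = 0) (η : ℝ) :
    ft1 h (-η) = (starRingEnd ℂ) (ft1 h η) := by
  unfold ft1
  rw [← integral_conj]
  congr 1; ext t
  rw [map_mul, Complex.conj_eq_iff_im.2 (hreal t), ← Complex.exp_conj]
  congr 2
  simp

lemma half (h : SchwartzMap ℝ ℂ) (hreal : ∀ t : ℝ, (h t).im = 0) :
    (∫ η : ℝ, ‖ft1 h η‖ ^ 2) = 2 * ∫ η in Set.Ioi (0:ℝ), ‖ft1 h η‖ ^ 2 := by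
  rw [← integral_comp_abs (f := fun η => ‖ft1 h η‖ ^ 2)]
  congr 1; ext η
  rcases abs_choice η with e | e <;> rw [e]
  rw [ft1_neg h hreal, RCLike.norm_conj]

lemma ftn_ray {n : ℕ} (h : SchwartzMap ℝ ℂ) (f : SchwartzMap (EuclideanSpace ℝ (Fin n)) ℂ)
    (v ξ : EuclideanSpace ℝ (Fin n)) :
    ftn (fun u => windowedRay h f u v) ξ = ftn f ξ * ft1 h (-⟪v, ξ⟫) := by
  have key : ∀ t : ℝ, (∫ u, f (u + t • v) * h t * Complex.exp (-(Complex.I * (⟪u, ξ⟫ : ℝ))))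
      = ftn f ξ * (h t * Complex.exp (-(Complex.I * t * (-⟪v, ξ⟫ : ℝ)))) := by
    intro t
    unfold ftn
    rw [← integral_mul_const]
    rw [← integral_add_right_eq_self (fun u => f u * Complex.exp (-(Complex.I * (⟪u, ξ⟫ : ℝ))) *
      (h t * Complex.exp (-(Complex.I * t * (-⟪v, ξ⟫ : ℝ))))) (t • v)]
    congr 1; ext u
    rw [mul_mul_mul_comm, ← Complex.exp_add]
    congr 2
    rw [inner_add_left, inner_smul_left]
    push_cast
    simp
    ring
  have hint : Integrable (fun p : EuclideanSpace ℝ (Fin n) × ℝ =>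
      f (p.1 + p.2 • v) * h p.2 * Complex.exp (-(Complex.I * (⟪p.1, ξ⟫ : ℝ))))
      (volume.prod volume) := by
    have hc : Continuous (fun p : EuclideanSpace ℝ (Fin n) × ℝ =>
      f (p.1 + p.2 • v) * h p.2 * Complex.exp (-(Complex.I * (⟪p.1, ξ⟫ : ℝ)))) := by
      have := f.continuous
      have := h.continuous
      fun_prop
    have hn : ∀ (u : EuclideanSpace ℝ (Fin n)) (t : ℝ), 
        ‖f (u + t • v) * h t * Complex.exp (-(Complex.I * (⟪u, ξ⟫ : ℝ)))‖ 
          = ‖f (u + t • v)‖ * ‖h t‖ := by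
      intro u t
      rw [norm_mul, norm_mul, Complex.norm_exp]
      simp
    rw [integrable_prod_iff' hc.aestronglyMeasurable]
    constructor
    · refine .of_forall fun t => ?_
      have h1 := ((f.integrable (μ := volume)).comp_add_right (t • v)).norm.mul_const ‖h t‖
      refine h1.mono' (hc.comp (by fun_prop : Continuous fun u => (u, t))).aestronglyMeasurable ?_
      exact .of_forall fun u => (hn u t).le
    · simp_rw [hn, integral_mul_const]
      have : ∀ t : ℝ, ∫ u, ‖f (u + t • v)‖ = ∫ u, ‖f u‖ := fun t =>
        integral_add_right_eq_self (fun u => ‖f u‖) (t • v)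
      simp_rw [this]
      exact h.integrable.norm.const_mul _
  calc ftn (fun u => windowedRay h f u v) ξ 
      = ∫ u, ∫ t : ℝ, f (u + t • v) * h t * Complex.exp (-(Complex.I * (⟪u, ξ⟫ : ℝ))) := by
        unfold ftn windowedRay
        simp_rw [integral_mul_const]
    _ = ∫ t : ℝ, ∫ u, f (u + t • v) * h t * Complex.exp (-(Complex.I * (⟪u, ξ⟫ : ℝ))) :=
        integral_integral_swap hint
    _ = _ := by
        simp_rw [key, integral_const_mul]
        rfl

lemma ftn_inv {n : ℕ} (f : SchwartzMap (EuclideanSpace ℝ (Fin n)) ℂ)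
    (x : EuclideanSpace ℝ (Fin n)) :
    ∫ ξ, ftn f ξ * Complex.exp (Complex.I * (⟪ξ, x⟫ : ℝ)) = ((2 * π : ℝ) : ℂ) ^ n * f x := by
  have hpi : (π : ℂ) ≠ 0 := by exact_mod_cast Real.pi_ne_zero
  have e : ∀ ξ, ftn f ξ * Complex.exp (Complex.I * (⟪ξ, x⟫ : ℝ)) = 
    (fun η => Complex.exp ((2 * π * ⟪η, x⟫ : ℝ) * Complex.I) • (𝓕 f) η) ((2 * π)⁻¹ • ξ) := by
    intro ξ
    simp only [ftn_eq, smul_eq_mul]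
    rw [mul_comm]
    congr 2
    rw [inner_smul_left]
    push_cast
    simp
    field_simp
  rw [integral_congr_ae (.of_forall e), Measure.integral_comp_smul volume
    (fun η => Complex.exp ((2 * π * ⟪η, x⟫ : ℝ) * Complex.I) •
      (𝓕 f : SchwartzMap (EuclideanSpace ℝ (Fin n)) ℂ) η) (2 * π)⁻¹]
  have : f x = 𝓕⁻ (𝓕 f) x := by rw [FourierTransform.fourierInv_fourier_eq]
  rw [this, SchwartzMap.fourierInv_coe, Real.fourierInv_eq']
  rw [finrank_euclideanSpace_fin, inv_pow, inv_inv, abs_of_pos (by have := Real.pi_pos; positivity)]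
  rw [Complex.real_smul]
  push_cast
  rfl

lemma ftn_integrable {n : ℕ} (f : SchwartzMap (EuclideanSpace ℝ (Fin n)) ℂ)
    (x : EuclideanSpace ℝ (Fin n)) :
    Integrable (fun ξ => ftn f ξ * Complex.exp (Complex.I * (⟪ξ, x⟫ : ℝ))) := by
  have h1 : Integrable (fun ξ => (𝓕 f) ((2 * π)⁻¹ • ξ)) := 
    ((𝓕 f).integrable (μ := volume)).comp_smul (by have := Real.pi_pos; positivity)
  simp_rw [ftn_eq]
  have hc : Continuous (fun ξ => (𝓕 f) ((2 * π)⁻¹ • ξ) * Complex.exp (Complex.I * (⟪ξ, x⟫ : ℝ))) := by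
    have := (𝓕 f).continuous
    fun_prop
  refine h1.norm.mono' hc.aestronglyMeasurable (.of_forall fun ξ => ?_)
  rw [norm_mul, Complex.norm_exp]
  simp

lemma polar {n : ℕ} (hn : 2 ≤ n) (g : EuclideanSpace ℝ (Fin n) → ℂ) (hg : Integrable g) :
    ∫ ξ, g ξ = ∫ θ : Metric.sphere (0 : EuclideanSpace ℝ (Fin n)) 1,
      (∫ σ in Set.Ioi (0 : ℝ), g (σ • (θ : EuclideanSpace ℝ (Fin n))) * (σ : ℂ) ^ (n - 1))
        ∂((volume : Measure (EuclideanSpace ℝ (Fin n))).toSphere) := by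
  have hnt : Nontrivial (EuclideanSpace ℝ (Fin n)) :=
    Module.nontrivial_of_finrank_pos (R := ℝ) (by rw [finrank_euclideanSpace_fin]; omega)
  let μ : Measure (EuclideanSpace ℝ (Fin n)) := volume
  let E := EuclideanSpace ℝ (Fin n)
  let G : Metric.sphere (0 : E) 1 × Set.Ioi (0:ℝ) → ℂ := fun p => g ((p.2 : ℝ) • (p.1 : E))
  have hG : ∀ y : ({(0)}ᶜ : Set E), G (homeomorphUnitSphereProd E y) = g y := by
    intro y
    simp only [G]
    congr 1
    have := (homeomorphUnitSphereProd E).symm_apply_apply y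
    conv_rhs => rw [← this]
    rw [homeomorphUnitSphereProd_symm_apply_coe]
  have mp := μ.measurePreserving_homeomorphUnitSphereProd
  have hGi : Integrable G (μ.toSphere.prod (.volumeIoiPow (Module.finrank ℝ E - 1))) := by
    rw [← mp.integrable_comp_emb (Homeomorph.measurableEmbedding _)]
    have : G ∘ homeomorphUnitSphereProd E = g ∘ Subtype.val := by ext y; exact hG y
    rw [this, ← integrableOn_iff_comap_subtypeVal (measurableSet_singleton _).compl]
    exact hg.integrableOn
  calc ∫ ξ, g ξ = ∫ y : ({(0)}ᶜ : Set E), g y ∂(μ.comap (↑)) := by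
        rw [integral_subtype_comap (measurableSet_singleton _).compl,
          restrict_compl_singleton]
    _ = ∫ p, G p ∂μ.toSphere.prod (.volumeIoiPow (Module.finrank ℝ E - 1)) := by
      refine Eq.trans ?_ (mp.integral_comp (Homeomorph.measurableEmbedding _) G)
      exact integral_congr_ae (.of_forall fun y => (hG y).symm)
    _ = ∫ θ, ∫ σ, G (θ, σ) ∂(.volumeIoiPow (Module.finrank ℝ E - 1)) ∂μ.toSphere := 
      integral_prod _ hGi
    _ = _ := by
      congr 1; ext θ
      rw [finrank_euclideanSpace_fin]
      simp only [Measure.volumeIoiPow, ENNReal.ofReal, G]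
      rw [integral_withDensity_eq_integral_smul,
        integral_subtype_comap measurableSet_Ioi
          fun a : ℝ ↦ Real.toNNReal (a ^ (n - 1)) • g (a • (θ : E)),
        setIntegral_congr_fun measurableSet_Ioi fun x hx ↦ ?_]
      · rw [NNReal.smul_def, Real.coe_toNNReal _ (pow_nonneg (le_of_lt hx) _), Complex.real_smul, mul_comm]
        push_cast; rfl
      · exact (measurable_subtype_coe.pow_const _).real_toNNReal

theorem stmt7 {n : ℕ} (hn : 2 ≤ n) (h : SchwartzMap ℝ ℂ) (hh : h ≠ 0)
    (hreal : ∀ t : ℝ, (h t).im = 0)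
    (f : SchwartzMap (EuclideanSpace ℝ (Fin n)) ℂ) (x : EuclideanSpace ℝ (Fin n)) :
    f x = 2 * (((2 * Real.pi : ℝ) : ℂ) ^ (n : ℕ))⁻¹ *
        ((∫ η : ℝ, ‖ft1 h η‖ ^ 2 : ℝ) : ℂ)⁻¹ *
      ∫ θ : Metric.sphere (0 : EuclideanSpace ℝ (Fin n)) 1,
        (∫ σ in Set.Ioi (0 : ℝ),
          (∫ r in Set.Ioi (0 : ℝ),
              ftn (fun u => windowedRay h f u (r • (θ : EuclideanSpace ℝ (Fin n))))
                  (σ • (θ : EuclideanSpace ℝ (Fin n))) * ft1 h (r * σ)) *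
            Complex.exp (Complex.I * σ * (⟪(θ : EuclideanSpace ℝ (Fin n)), x⟫ : ℝ)) *
            ((σ : ℂ) ^ (n : ℕ)))
        ∂((volume : Measure (EuclideanSpace ℝ (Fin n))).toSphere) := by
  set C := ∫ η : ℝ, ‖ft1 h η‖ ^ 2 with hC
  have hC0 : (C : ℂ) ≠ 0 := by exact_mod_cast ft1_sq_ne h hh
  have inner_r : ∀ θ : Metric.sphere (0 : EuclideanSpace ℝ (Fin n)) 1, ∀ σ : ℝ, 0 < σ →
      (∫ r in Set.Ioi (0 : ℝ),
              ftn (fun u => windowedRay h f u (r • (θ : EuclideanSpace ℝ (Fin n))))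
                  (σ • (θ : EuclideanSpace ℝ (Fin n))) * ft1 h (r * σ)) 
        = ftn f (σ • (θ : EuclideanSpace ℝ (Fin n))) * ((σ : ℂ)⁻¹ * ((C : ℂ) / 2)) := by
    intro θ σ hσ
    have hθ : ⟪(θ : EuclideanSpace ℝ (Fin n)), (θ : EuclideanSpace ℝ (Fin n))⟫ = 1 := by
      rw [real_inner_self_eq_norm_sq, norm_eq_of_mem_sphere]; norm_num
    have e : ∀ r : ℝ, ftn (fun u => windowedRay h f u (r • (θ : EuclideanSpace ℝ (Fin n))))
                  (σ • (θ : EuclideanSpace ℝ (Fin n))) * ft1 h (r * σ)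
        = ftn f (σ • (θ : EuclideanSpace ℝ (Fin n))) * ((‖ft1 h (r * σ)‖ ^ 2 : ℝ) : ℂ) := by
      intro r
      rw [ftn_ray, inner_smul_left, inner_smul_right, hθ, mul_one, mul_assoc]
      simp only [conj_trivial]
      rw [ft1_neg h hreal, Complex.conj_mul']
      push_cast; rfl
    simp_rw [e]
    rw [integral_const_mul, integral_complex_ofReal,
      integral_comp_mul_right_Ioi (fun y => ‖ft1 h y‖ ^ 2) 0 hσ, zero_mul, hC, half h hreal]
    push_cast
    simp
  have main : (∫ θ : Metric.sphere (0 : EuclideanSpace ℝ (Fin n)) 1,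
        (∫ σ in Set.Ioi (0 : ℝ),
          (∫ r in Set.Ioi (0 : ℝ),
              ftn (fun u => windowedRay h f u (r • (θ : EuclideanSpace ℝ (Fin n))))
                  (σ • (θ : EuclideanSpace ℝ (Fin n))) * ft1 h (r * σ)) *
            Complex.exp (Complex.I * σ * (⟪(θ : EuclideanSpace ℝ (Fin n)), x⟫ : ℝ)) *
            ((σ : ℂ) ^ (n : ℕ)))
        ∂((volume : Measure (EuclideanSpace ℝ (Fin n))).toSphere)) 
      = (C : ℂ) / 2 * (((2 * π : ℝ) : ℂ) ^ n * f x) := by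
    rw [← ftn_inv, polar hn _ (ftn_integrable f x), ← integral_const_mul]
    congr 1; ext θ
    rw [← integral_const_mul]
    refine setIntegral_congr_fun measurableSet_Ioi fun σ hσ => ?_
    have hσ' : (σ : ℂ) ≠ 0 := by exact_mod_cast (ne_of_gt hσ)
    rw [inner_r θ σ hσ, inner_smul_left]
    obtain ⟨m, rfl⟩ : ∃ m, n = m + 1 := ⟨n - 1, by omega⟩
    simp only [conj_trivial, Nat.add_sub_cancel, pow_succ]
    push_cast
    rw [← mul_assoc Complex.I]
    field_simp
  rw [main]
  have hp : ((2 * π : ℝ) : ℂ) ^ n ≠ 0 := by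
    apply pow_ne_zero
    exact_mod_cast (by have := Real.pi_pos; positivity : (2 * π : ℝ) ≠ 0)
  field_simp
end

section
/- Let f ∈ 𝒮(ℝⁿ), h ∈ 𝒮(ℝ), and write points of ℝⁿ as (x₁,x') ∈ ℝ×ℝ^{n−1}. For u = (u₁,u'), v = (v₁,v'), the partial 2-dimensional Fourier transform of P_h f(u,v) in the variables (u₁,v₁), evaluated at (σ, aσ) for σ ≠ 0 and a ∈ ℝ, equals (2π/|σ|) · f̂(σ, a v' + u') · h(a), where f̂ denotes the Fourier transform of f in its first coordinate x₁ only. In particular, if h(a) ≠ 0 then f̂(σ, av'+u') = (|σ|/(2π h(a))) · ∬ P_h f(u,v) e^{−i(u₁ + a v₁)σ} du₁ dv₁. -/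
open MeasureTheory Real Complex SchwartzMap
open scoped RealInnerProductSpace

/-- Windowed ray transform on `ℝ × ℝ^{n-1}`. -/
noncomputable def windowedRayP {m : ℕ} (h : ℝ → ℂ) (f : ℝ × EuclideanSpace ℝ (Fin m) → ℂ)
    (u v : ℝ × EuclideanSpace ℝ (Fin m)) : ℂ :=
  ∫ t : ℝ, f (u + t • v) * h t

/-- Fourier transform of `f` in its first coordinate only. -/
noncomputable def ftFirst {m : ℕ} (f : ℝ × EuclideanSpace ℝ (Fin m) → ℂ) (σ : ℝ)
    (y : EuclideanSpace ℝ (Fin m)) : ℂ :=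
  ∫ x₁ : ℝ, f (x₁, y) * Complex.exp (-(Complex.I * x₁ * σ))

open scoped FourierTransform LineDeriv

lemma aux_bound {m : ℕ} (f : SchwartzMap (ℝ × EuclideanSpace ℝ (Fin m)) ℂ) :
    ∃ C : ℝ, 0 < C ∧ ∀ x y, ‖f (x, y)‖ ≤ C * (1 + x ^ 2)⁻¹ := by
  obtain ⟨C0, hC0, h0⟩ := f.decay 0 0
  obtain ⟨C2, hC2, h2⟩ := f.decay 2 0
  refine ⟨C0 + C2, by positivity, fun x y => ?_⟩
  have h0' := h0 (x, y)
  have h2' := h2 (x, y)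
  simp only [norm_iteratedFDeriv_zero, pow_zero, one_mul] at h0' h2'
  have hx : x ^ 2 ≤ ‖(x, y)‖ ^ 2 := by
    rw [← sq_abs]
    exact pow_le_pow_left₀ (abs_nonneg x) (norm_fst_le (x, y)) 2
  rw [← div_eq_mul_inv, le_div_iff₀ (by positivity)]
  nlinarith [norm_nonneg (f (x, y)), mul_le_mul_of_nonneg_right hx (norm_nonneg (f (x, y)))]

lemma aux_exp_norm (x σ : ℝ) : ‖Complex.exp (-(Complex.I * x * σ))‖ = 1 := by
  have : -(Complex.I * x * σ) = ((-(x * σ) : ℝ) : ℂ) * Complex.I := by push_cast; ring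
  rw [this, Complex.norm_exp_ofReal_mul_I]

lemma aux_integrable {m : ℕ} (f : SchwartzMap (ℝ × EuclideanSpace ℝ (Fin m)) ℂ) (σ : ℝ)
    (y : EuclideanSpace ℝ (Fin m)) :
    Integrable (fun x : ℝ => f (x, y) * Complex.exp (-(Complex.I * x * σ))) := by
  obtain ⟨C, hC, hb⟩ := aux_bound f
  have hf := f.continuous
  refine (integrable_inv_one_add_sq.const_mul C).mono'
    (Continuous.aestronglyMeasurable (by fun_prop)) (Filter.Eventually.of_forall fun x => ?_)
  rw [norm_mul, aux_exp_norm, mul_one]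
  exact hb x y

lemma aux_ft_bound {m : ℕ} (f : SchwartzMap (ℝ × EuclideanSpace ℝ (Fin m)) ℂ) (σ : ℝ) :
    ∃ C : ℝ, ∀ y, ‖ftFirst f σ y‖ ≤ C := by
  obtain ⟨C, hC, hb⟩ := aux_bound f
  refine ⟨∫ x : ℝ, C * (1 + x ^ 2)⁻¹, fun y => ?_⟩
  refine norm_integral_le_of_norm_le (integrable_inv_one_add_sq.const_mul C)
    (Filter.Eventually.of_forall fun x => ?_)
  rw [norm_mul, aux_exp_norm, mul_one]
  exact hb x y

lemma aux_ft_deriv {m : ℕ} (f : SchwartzMap (ℝ × EuclideanSpace ℝ (Fin m)) ℂ) (σ : ℝ)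
    (u' v' : EuclideanSpace ℝ (Fin m)) (t : ℝ) :
    HasDerivAt (fun t : ℝ => ftFirst f σ (u' + t • v'))
      (ftFirst (∂_{((0 : ℝ), v')} f : SchwartzMap (ℝ × EuclideanSpace ℝ (Fin m)) ℂ) σ
        (u' + t • v')) t := by
  set g : SchwartzMap (ℝ × EuclideanSpace ℝ (Fin m)) ℂ := ∂_{((0 : ℝ), v')} f with hg
  obtain ⟨C, hC, hb⟩ := aux_bound g
  unfold ftFirst
  refine (hasDerivAt_integral_of_dominated_loc_of_deriv_le
    (F := fun (t : ℝ) (x : ℝ) => f (x, u' + t • v') * Complex.exp (-(Complex.I * x * σ)))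
    (F' := fun (t : ℝ) (x : ℝ) => g (x, u' + t • v') * Complex.exp (-(Complex.I * x * σ)))
    (bound := fun x => C * (1 + x ^ 2)⁻¹) (s := Set.univ) Filter.univ_mem
    (Filter.Eventually.of_forall fun t => (aux_integrable f σ _).aestronglyMeasurable)
    (aux_integrable f σ _) (aux_integrable g σ _).aestronglyMeasurable
    (Filter.Eventually.of_forall fun x t _ => ?_) (integrable_inv_one_add_sq.const_mul C)
    (Filter.Eventually.of_forall fun x t _ => ?_)).2
  · rw [norm_mul, aux_exp_norm, mul_one]
    exact hb x _
  · refine HasDerivAt.mul_const ?_ _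
    have h1 : HasDerivAt (fun t : ℝ => (x, u' + t • v')) ((0 : ℝ), v') t := by
      refine (hasDerivAt_const t x).prodMk ?_
      simpa using ((hasDerivAt_id t).smul_const v').const_add u'
    have h2 := (f.differentiable (x, u' + t • v')).hasFDerivAt.comp_hasDerivAt t h1
    simpa [hg, SchwartzMap.lineDerivOp_apply_eq_fderiv, Function.comp_def] using h2

lemma aux_int_mul (h : SchwartzMap ℝ ℂ) (F : ℝ → ℂ) (hF : Continuous F) (C : ℝ)
    (hC : ∀ t, ‖F t‖ ≤ C) : Integrable (fun t => h t * F t) :=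
  h.integrable.mul_bdd (c := C) hF.aestronglyMeasurable (Filter.Eventually.of_forall hC)

lemma aux_fourier_bound (g : ℝ → ℂ) (w : ℝ) : ‖𝓕 g w‖ ≤ ∫ t, ‖g t‖ := by
  rw [Real.fourier_real_eq]
  refine (norm_integral_le_integral_norm _).trans (le_of_eq ?_)
  simp

lemma aux_fourier_integrable (g g' g'' : ℝ → ℂ) (h0 : Integrable g) (h1 : Integrable g')
    (h2 : Integrable g'') (d1 : ∀ t, HasDerivAt g (g' t) t) (d2 : ∀ t, HasDerivAt g' (g'' t) t) :
    Integrable (𝓕 g) := by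
  have e1 : deriv g = g' := funext fun t => (d1 t).deriv
  have e2 : deriv g' = g'' := funext fun t => (d2 t).deriv
  have f1 := Real.fourier_deriv h0 (fun t => (d1 t).differentiableAt) (e1 ▸ h1)
  have f2 := Real.fourier_deriv h1 (fun t => (d2 t).differentiableAt) (e2 ▸ h2)
  rw [e1] at f1
  rw [e2] at f2
  have hc : Continuous (𝓕 g) := VectorFourier.fourierIntegral_continuous
    Real.continuous_fourierChar (innerSL ℝ).continuous₂ h0
  set A := ∫ t, ‖g t‖
  set B := ∫ t, ‖g'' t‖
  refine (integrable_inv_one_add_sq.const_mul (A + B)).mono' hc.aestronglyMeasurable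
    (Filter.Eventually.of_forall fun w => ?_)
  have b0 := aux_fourier_bound g w
  have b2 := aux_fourier_bound g'' w
  rw [f2, f1] at b2
  simp only [norm_smul, norm_mul, Complex.norm_I, Complex.norm_real, Complex.norm_ofNat,
    Real.norm_eq_abs, mul_one, abs_of_pos Real.pi_pos] at b2
  rw [← div_eq_mul_inv, le_div_iff₀ (by positivity)]
  have hw : |w| * |w| = w ^ 2 := by rw [← sq, sq_abs]
  have hpi : 1 ≤ (2 * π) * (2 * π) := by nlinarith [Real.pi_gt_three]
  have : w ^ 2 * ‖𝓕 g w‖ ≤ B := by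
    calc w ^ 2 * ‖𝓕 g w‖ ≤ ((2 * π) * (2 * π)) * (w ^ 2 * ‖𝓕 g w‖) :=
          le_mul_of_one_le_left (by positivity) hpi
      _ = 2 * π * |w| * (2 * π * |w| * ‖𝓕 g w‖) := by rw [← hw]; ring
      _ ≤ B := b2
  linarith

lemma aux_inv (g : ℝ → ℂ) (hg : Continuous g) (h0 : Integrable g) (h1 : Integrable (𝓕 g))
    (σ : ℝ) (hσ : σ ≠ 0) (a : ℝ) :
    ∫ v : ℝ, ∫ t : ℝ, Complex.exp (Complex.I * (t - a) * v * σ) * g t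
      = ((2 * Real.pi : ℝ) : ℂ) * g a * ((|σ|⁻¹ : ℝ) : ℂ) := by
  have hinv : 𝓕⁻ (𝓕 g) a = g a := congrFun (hg.fourierInv_fourier_eq h0 h1) a
  have hpi := Real.pi_pos
  have hpi' : (π : ℂ) ≠ 0 := by exact_mod_cast hpi.ne'
  rw [Real.fourierInv_eq'] at hinv
  have key : ∀ v : ℝ, ∫ t : ℝ, Complex.exp (Complex.I * (t - a) * v * σ) * g t
      = (fun w : ℝ => Complex.exp (((2 * π * (inner ℝ w a) : ℝ) : ℂ) * Complex.I) • 𝓕 g w)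
        (-(σ / (2 * π)) * v) := by
    intro v
    simp only [Real.fourier_eq', smul_eq_mul]
    rw [← integral_const_mul]
    congr 1
    ext t
    rw [← mul_assoc, ← Complex.exp_add]
    congr 2
    simp
    field_simp
    ring
  rw [integral_congr_ae (Filter.Eventually.of_forall key), Measure.integral_comp_mul_left
    (fun w : ℝ => Complex.exp (((2 * π * (inner ℝ w a) : ℝ) : ℂ) * Complex.I) • 𝓕 g w), hinv, Complex.real_smul]
  rw [inv_neg, abs_neg, inv_div, abs_div, abs_of_pos (by positivity : 0 < 2 * π)]
  push_cast
  ring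

lemma aux_inner {m : ℕ} (f : SchwartzMap (ℝ × EuclideanSpace ℝ (Fin m)) ℂ) (h : SchwartzMap ℝ ℂ)
    (σ a : ℝ) (u' v' : EuclideanSpace ℝ (Fin m)) (v₁ : ℝ) :
    ∫ u₁ : ℝ,
        windowedRayP h f (u₁, u') (v₁, v') * Complex.exp (-(Complex.I * (u₁ + a * v₁) * σ))
      = ∫ t : ℝ, Complex.exp (Complex.I * (t - a) * v₁ * σ) *
          (h t * ftFirst f σ (u' + t • v')) := by
  obtain ⟨C, hC, hb⟩ := aux_bound f
  have hf := f.continuous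
  have hh := h.continuous
  have hB : Integrable (fun p : ℝ × ℝ => C * (1 + (p.1 + p.2 * v₁) ^ 2)⁻¹ * ‖h p.2‖)
      (volume.prod volume) := by
    have hcont : Continuous (fun p : ℝ × ℝ => C * (1 + (p.1 + p.2 * v₁) ^ 2)⁻¹ * ‖h p.2‖) := by
      have : ∀ p : ℝ × ℝ, 1 + (p.1 + p.2 * v₁) ^ 2 ≠ 0 := fun p => by positivity
      fun_prop (disch := assumption)
    rw [integrable_prod_iff' hcont.aestronglyMeasurable]
    refine ⟨Filter.Eventually.of_forall fun t => ?_, ?_⟩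
    · exact ((integrable_inv_one_add_sq.comp_add_right (t * v₁)).const_mul C).mul_const ‖h t‖
    · have : ∀ t : ℝ, ∫ u : ℝ, ‖C * (1 + (u + t * v₁) ^ 2)⁻¹ * ‖h t‖‖
          = (∫ u : ℝ, C * (1 + u ^ 2)⁻¹) * ‖h t‖ := by
        intro t
        rw [← integral_add_right_eq_self (fun u : ℝ => C * (1 + u ^ 2)⁻¹) (t * v₁),
          ← integral_mul_const]
        congr 1
        ext u
        rw [Real.norm_of_nonneg (by positivity)]
      simp only [this]
      exact h.integrable.norm.const_mul _
  have hI : Integrable (Function.uncurry fun (u t : ℝ) => f ((u, u') + t • (v₁, v')) * h t *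
      Complex.exp (-(Complex.I * (u + a * v₁) * σ))) (volume.prod volume) := by
    refine hB.mono' (Continuous.aestronglyMeasurable ?_) (Filter.Eventually.of_forall ?_)
    · simp only [Function.uncurry_def]; fun_prop
    · rintro ⟨u, t⟩
      have := aux_exp_norm (u + a * v₁) σ
      push_cast at this
      simp only [Function.uncurry_apply_pair, norm_mul, this, mul_one]
      gcongr
      simpa using hb (u + t * v₁) (u' + t • v')
  unfold windowedRayP
  simp_rw [← integral_mul_const]
  rw [integral_integral_swap hI]
  congr 1
  ext t
  unfold ftFirst
  rw [← integral_add_right_eq_self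
    (fun x : ℝ => f (x, u' + t • v') * Complex.exp (-(Complex.I * x * σ))) (t * v₁), ← mul_assoc, ← integral_const_mul]
  congr 1
  ext u
  have : Complex.exp (-(Complex.I * (u + a * v₁) * σ)) =
      Complex.exp (Complex.I * (t - a) * v₁ * σ) *
        Complex.exp (-(Complex.I * ((u + t * v₁ : ℝ) : ℂ) * σ)) := by
    rw [← Complex.exp_add]
    congr 1
    push_cast
    ring
  rw [this]
  simp only [Prod.smul_mk, Prod.mk_add_mk, smul_eq_mul]
  ring

lemma aux_main {m : ℕ} (f : SchwartzMap (ℝ × EuclideanSpace ℝ (Fin m)) ℂ) (h : SchwartzMap ℝ ℂ)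
    (σ : ℝ) (hσ : σ ≠ 0) (a : ℝ) (u' v' : EuclideanSpace ℝ (Fin m)) :
    (∫ v₁ : ℝ, ∫ u₁ : ℝ,
        windowedRayP h f (u₁, u') (v₁, v') * Complex.exp (-(Complex.I * (u₁ + a * v₁) * σ)))
      = ((2 * Real.pi : ℝ) : ℂ) * ftFirst f σ (a • v' + u') * h a * ((|σ|⁻¹ : ℝ) : ℂ) := by
  simp_rw [aux_inner]
  set f1 : SchwartzMap (ℝ × EuclideanSpace ℝ (Fin m)) ℂ := ∂_{((0 : ℝ), v')} f with hf1
  set f2 : SchwartzMap (ℝ × EuclideanSpace ℝ (Fin m)) ℂ := ∂_{((0 : ℝ), v')} f1 with hf2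
  set h1 := SchwartzMap.derivCLM ℂ ℂ h with hh1
  set h2 := SchwartzMap.derivCLM ℂ ℂ h1 with hh2
  have dh : ∀ t, HasDerivAt h (h1 t) t := fun t => (h.differentiable t).hasDerivAt
  have dh1 : ∀ t, HasDerivAt h1 (h2 t) t := fun t => (h1.differentiable t).hasDerivAt
  have d0 := aux_ft_deriv f σ u' v'
  have d1 := aux_ft_deriv f1 σ u' v'
  have I : ∀ (k : SchwartzMap ℝ ℂ) (φ : SchwartzMap (ℝ × EuclideanSpace ℝ (Fin m)) ℂ),
      Integrable (fun t => k t * ftFirst φ σ (u' + t • v')) := by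
    intro k φ
    obtain ⟨C, hC⟩ := aux_ft_bound φ σ
    exact aux_int_mul k _ (continuous_iff_continuousAt.2 fun t =>
      (aux_ft_deriv φ σ u' v' t).continuousAt) C fun t => hC _
  have dg : ∀ t, HasDerivAt (fun t => h t * ftFirst f σ (u' + t • v'))
      (h1 t * ftFirst f σ (u' + t • v') + h t * ftFirst f1 σ (u' + t • v')) t :=
    fun t => (dh t).mul (d0 t)
  have dg1 : ∀ t, HasDerivAt
      (fun t => h1 t * ftFirst f σ (u' + t • v') + h t * ftFirst f1 σ (u' + t • v'))
      ((h2 t * ftFirst f σ (u' + t • v') + h1 t * ftFirst f1 σ (u' + t • v')) +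
      (h1 t * ftFirst f1 σ (u' + t • v') + h t * ftFirst f2 σ (u' + t • v'))) t :=
    fun t => ((dh1 t).mul (d0 t)).add ((dh t).mul (d1 t))
  have hF := aux_fourier_integrable _ _ _ (I h f) ((I h1 f).add (I h f1))
    (((I h2 f).add (I h1 f1)).add ((I h1 f1).add (I h f2))) dg dg1
  rw [aux_inv (fun t => h t * ftFirst f σ (u' + t • v'))
    (continuous_iff_continuousAt.2 fun t => (dg t).continuousAt) (I h f) hF σ hσ a, add_comm u']
  ring

theorem stmt8 {m : ℕ} (f : SchwartzMap (ℝ × EuclideanSpace ℝ (Fin m)) ℂ) (h : SchwartzMap ℝ ℂ)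
    (σ : ℝ) (hσ : σ ≠ 0) (a : ℝ) (u' v' : EuclideanSpace ℝ (Fin m)) :
    (∫ v₁ : ℝ, ∫ u₁ : ℝ,
        windowedRayP h f (u₁, u') (v₁, v') * Complex.exp (-(Complex.I * (u₁ + a * v₁) * σ)))
      = ((2 * Real.pi : ℝ) : ℂ) * ftFirst f σ (a • v' + u') * h a * ((|σ|⁻¹ : ℝ) : ℂ) ∧
    (h a ≠ 0 → ftFirst f σ (a • v' + u')
      = ((|σ| : ℝ) : ℂ) / (((2 * Real.pi : ℝ) : ℂ) * h a) *
          ∫ v₁ : ℝ, ∫ u₁ : ℝ,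
            windowedRayP h f (u₁, u') (v₁, v') *
              Complex.exp (-(Complex.I * (u₁ + a * v₁) * σ))) := by
  have hm := aux_main f h σ hσ a u' v'
  refine ⟨hm, fun ha => ?_⟩
  rw [hm]
  have h1 : ((|σ| : ℝ) : ℂ) ≠ 0 := by exact_mod_cast abs_ne_zero.2 hσ
  have h2 : ((2 * Real.pi : ℝ) : ℂ) ≠ 0 := by exact_mod_cast (by positivity : 2 * Real.pi ≠ 0)
  rw [Complex.ofReal_inv]
  field_simp
end
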